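/- For every real ε > 0 there exists N such that for every n ≥ N and every simple 2-CNF formula φ with at most n variables, there exists a 2-CNF formula φ' such that φ ⊢* φ' and |φ'| ≤ (log₂(3)/4 + ε) · n² / log₂ n. -/

import Mathlib

namespace BVAPaper

/-- A literal is a propositional variable (a natural number) together with a
polarity: `true` for a positive literal, `false` for a negative one. -/
abbrev Lit := ℕ × Bool

/-- A clause is a finite set of literals (required to be pairwise
non-complementary via `IsClause`). -/
abbrev Clause := Finset Lit

/-- A formula is a finite set of clauses; its size is its number of clauses. -/
abbrev Formula := Finset Clause

/-- A genuine clause: it contains no pair of complementary literals. -/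
def IsClause (C : Clause) : Prop := ∀ v : ℕ, ¬ ((v, true) ∈ C ∧ (v, false) ∈ C)

/-- A 2-CNF formula: every member is a genuine clause with exactly two literals. -/
def Is2CNF (φ : Formula) : Prop := ∀ C ∈ φ, IsClause C ∧ C.card = 2

/-- The set of variables occurring in a formula. -/
def Vars (φ : Formula) : Finset ℕ := φ.biUnion (fun C => C.image Prod.fst)

/-- A literal is true under an assignment. -/
def LitTrue (τ : ℕ → Bool) (l : Lit) : Prop := τ l.1 = l.2

/-- An assignment satisfies a formula if it makes some literal of every clause true. -/
def Satisfies (τ : ℕ → Bool) (φ : Formula) : Prop := ∀ C ∈ φ, ∃ l ∈ C, LitTrue τ l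

/-- `φ` semantically implies the equivalence of the literals `l₁` and `l₂`. -/
def ImpliesEquiv (φ : Formula) (l₁ l₂ : Lit) : Prop :=
  ∀ τ : ℕ → Bool, Satisfies τ φ → (LitTrue τ l₁ ↔ LitTrue τ l₂)

/-- A simple 2-CNF formula: (a) no two distinct literals are implied equivalent,
(b) every clause contains a negative literal, (c) no two distinct clauses are over
the same pair of variables. -/
def IsSimple (φ : Formula) : Prop :=
  (∀ l₁ l₂ : Lit, l₁ ≠ l₂ → ¬ ImpliesEquiv φ l₁ l₂) ∧
  (∀ C ∈ φ, ∃ l ∈ C, l.2 = false) ∧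
  (∀ C₁ ∈ φ, ∀ C₂ ∈ φ, C₁.image Prod.fst = C₂.image Prod.fst → C₁ = C₂)

/-- A monotone formula: every literal occurring in it is positive. -/
def MonotoneFormula (φ : Formula) : Prop := ∀ C ∈ φ, ∀ l ∈ C, l.2 = true

/-- `𝒞 ⋈ 𝒟`: the set of clauses `C ∪ D` for `C ∈ 𝒞` and `D ∈ 𝒟`. -/
def JoinClauses (𝒞 𝒟 : Finset Clause) : Finset Clause :=
  (𝒞 ×ˢ 𝒟).image (fun p => p.1 ∪ p.2)

/-- One BVA step. -/
def BVAStep (φ φ' : Formula) : Prop :=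
  ∃ (𝒞 𝒟 : Finset Clause) (y : ℕ),
    (∀ C ∈ 𝒞, IsClause C ∧ C.Nonempty) ∧
    (∀ D ∈ 𝒟, IsClause D ∧ D.Nonempty) ∧
    JoinClauses 𝒞 𝒟 ⊆ φ ∧
    y ∉ Vars φ ∧
    φ' = (φ \ JoinClauses 𝒞 𝒟)
      ∪ 𝒞.image (fun C => insert ((y, true) : Lit) C)
      ∪ 𝒟.image (fun D => insert ((y, false) : Lit) D)

/-- Idealized BVA: the reflexive transitive closure of single BVA steps. -/
def BVAChain : Formula → Formula → Prop := Relation.ReflTransGen BVAStep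

/-- Negate the variables from `S` inside a literal. -/
def flipLit (S : Finset ℕ) (l : Lit) : Lit := if l.1 ∈ S then (l.1, !l.2) else l

/-- Negate the variables from `S` throughout a formula. -/
def flipFormula (S : Finset ℕ) (φ : Formula) : Formula :=
  φ.image (fun C => C.image (flipLit S))

/-- `φ ≅_W φ'`: `φ'` is obtained from `φ` by replacing some variables from `W`
by their negations wherever they appear. -/
def EquivW (W : Finset ℕ) (φ φ' : Formula) : Prop :=
  ∃ S ⊆ W, φ' = flipFormula S φ

/-- `φ'` encodes `φ` over the base variables `X`: for every assignment `τ` of `X`,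
`τ` satisfies `φ` iff `τ` extends to a satisfying assignment of `φ'`. -/
def Encodes (φ' φ : Formula) (X : Finset ℕ) : Prop :=
  ∀ τ : ℕ → Bool,
    Satisfies τ φ ↔ ∃ σ : ℕ → Bool, (∀ x ∈ X, σ x = τ x) ∧ Satisfies σ φ'

/-- The direct encoding of the at-most-one constraint on the variables `0, …, n-1`. -/
def atMostOne (n : ℕ) : Formula :=
  (((Finset.range n) ×ˢ (Finset.range n)).filter (fun p => p.1 < p.2)).image
    (fun p => ({(p.1, false), (p.2, false)} : Clause))

/-- A diagram: a graph with both undirected edges (represented as a symmetric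
set of ordered pairs) and directed edges. -/
structure Diagram where
  verts : Finset ℕ
  undir : Finset (ℕ × ℕ)
  dir : Finset (ℕ × ℕ)

/-- Well-formedness of a diagram: no loops, edges between vertices, the
undirected edge set is symmetric, and at most one edge between any two vertices. -/
def Diagram.WF (G : Diagram) : Prop :=
  (∀ e ∈ G.undir, e.1 ∈ G.verts ∧ e.2 ∈ G.verts ∧ e.1 ≠ e.2) ∧
  (∀ e ∈ G.dir, e.1 ∈ G.verts ∧ e.2 ∈ G.verts ∧ e.1 ≠ e.2) ∧
  (∀ u v : ℕ, (u, v) ∈ G.undir → (v, u) ∈ G.undir) ∧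
  (∀ u v : ℕ, (u, v) ∈ G.undir → (u, v) ∉ G.dir ∧ (v, u) ∉ G.dir) ∧
  (∀ u v : ℕ, (u, v) ∈ G.dir → (v, u) ∉ G.dir)

/-- The complete diagram `K_n` on vertices `0, …, n-1`: all edges undirected. -/
def completeDiagram (n : ℕ) : Diagram where
  verts := Finset.range n
  undir := ((Finset.range n) ×ˢ (Finset.range n)).filter (fun p => p.1 ≠ p.2)
  dir := ∅

/-- The diagram associated to a simple 2-CNF formula: an undirected edge
`{x, y}` for each clause `(¬x ∨ ¬y)` and a directed edge `(x, y)` for each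
clause `(¬x ∨ y)`. -/
def diagramOf (φ : Formula) : Diagram where
  verts := Vars φ
  undir := ((Vars φ) ×ˢ (Vars φ)).filter
    (fun p => ({(p.1, false), (p.2, false)} : Clause) ∈ φ)
  dir := ((Vars φ) ×ˢ (Vars φ)).filter
    (fun p => ({(p.1, false), (p.2, true)} : Clause) ∈ φ)

/-- A polarized diagram: a directed graph with a polarity on its edges
(`true` = `+`, `false` = `−`). -/
structure PolDiagram where
  verts : Finset ℕ
  edges : Finset (ℕ × ℕ)
  pol : ℕ × ℕ → Bool

/-- `(P, P.pol)` is a polarized diagram of the diagram `G`: every undirected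
edge of `G` is oriented (in exactly one way) with polarity `−`, and every
directed edge of `G` is kept with polarity `+`. -/
def IsPolarizationOf (P : PolDiagram) (G : Diagram) : Prop :=
  P.verts = G.verts ∧
  (∀ u v : ℕ, (u, v) ∈ G.dir ↔ ((u, v) ∈ P.edges ∧ P.pol (u, v) = true)) ∧
  (∀ u v : ℕ, (u, v) ∈ G.undir ↔
    (((u, v) ∈ P.edges ∧ P.pol (u, v) = false) ∨
     ((v, u) ∈ P.edges ∧ P.pol (v, u) = false))) ∧
  (∀ u v : ℕ, ¬ ((u, v) ∈ P.edges ∧ (v, u) ∈ P.edges))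

/-- A polarized rectifier network: base vertices, auxiliary vertices, directed
edges, and a polarity function (only meaningful on edges into base vertices). -/
structure PRN where
  base : Finset ℕ
  aux : Finset ℕ
  edges : Finset (ℕ × ℕ)
  pol : ℕ × ℕ → Bool

/-- Well-formedness of a PRN: base and auxiliary vertices are disjoint, and
edges are loopless edges between vertices. -/
def PRN.WF (R : PRN) : Prop :=
  Disjoint R.base R.aux ∧
  (∀ e ∈ R.edges, e.1 ∈ R.base ∪ R.aux ∧ e.2 ∈ R.base ∪ R.aux ∧ e.1 ≠ e.2)

/-- A valid walk from the base vertex `u` to the base vertex `v`: a sequence of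
length ≥ 2 of consecutive edges whose interior vertices are auxiliary. -/
def ValidWalk (R : PRN) (u v : ℕ) (π : List ℕ) : Prop :=
  2 ≤ π.length ∧
  π.head? = some u ∧ π.getLast? = some v ∧
  u ∈ R.base ∧ v ∈ R.base ∧
  List.Chain' (fun a b => (a, b) ∈ R.edges) π ∧
  (∀ i : ℕ, 0 < i → i + 1 < π.length → π.getD i 0 ∈ R.aux)

/-- The polarity of a walk: the polarity of its last edge. -/
def walkPol (R : PRN) (π : List ℕ) : Bool :=
  R.pol (π.getD (π.length - 2) 0, π.getD (π.length - 1) 0)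

/-- A strict polarized rectifier network: (1) for distinct base vertices `u, v`
there is at most one valid walk from `u` to `v` or from `v` to `u` in total, and
(2) every auxiliary vertex belongs to some valid walk. -/
def IsSPRN (R : PRN) : Prop :=
  (∀ u ∈ R.base, ∀ v ∈ R.base, u ≠ v →
    ∀ π₁ π₂ : List ℕ,
      (ValidWalk R u v π₁ ∨ ValidWalk R v u π₁) →
      (ValidWalk R u v π₂ ∨ ValidWalk R v u π₂) → π₁ = π₂) ∧
  (∀ a ∈ R.aux, ∃ u v : ℕ, ∃ π : List ℕ, ValidWalk R u v π ∧ a ∈ π)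

/-- The PRN `R` realizes the polarized diagram `P`. -/
def RealizesPol (R : PRN) (P : PolDiagram) : Prop :=
  R.base = P.verts ∧
  ∀ u ∈ P.verts, ∀ v ∈ P.verts,
    ((u, v) ∈ P.edges ↔ ∃ π : List ℕ, ValidWalk R u v π ∧ walkPol R π = P.pol (u, v))

/-- The PRN `R` realizes the diagram `G`: it realizes some polarized diagram of `G`. -/
def RealizesDiagram (R : PRN) (G : Diagram) : Prop :=
  ∃ P : PolDiagram, IsPolarizationOf P G ∧ RealizesPol R P

/-- The 2-CNF formula `F_R` associated to a PRN `R`. -/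
def PRN.formula (R : PRN) : Formula :=
  R.edges.image (fun e =>
    if e.2 ∈ R.base ∧ R.pol e = false
    then ({(e.1, false), (e.2, false)} : Clause)
    else ({(e.1, false), (e.2, true)} : Clause))

/-- The PRN associated to a polarized diagram (no auxiliary vertices). -/
def prnOfPol (P : PolDiagram) : PRN :=
  ⟨P.verts, ∅, P.edges, P.pol⟩

/-- A coherent biclique `(X, Y)` of a PRN. -/
def CoherentBiclique (R : PRN) (X Y : Finset ℕ) : Prop :=
  X.Nonempty ∧ Y.Nonempty ∧ Disjoint X Y ∧
  X ⊆ R.base ∪ R.aux ∧ Y ⊆ R.base ∪ R.aux ∧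
  (∀ x ∈ X, ∀ y ∈ Y, (x, y) ∈ R.edges) ∧
  (∀ y ∈ Y, y ∈ R.base → ∀ x₁ ∈ X, ∀ x₂ ∈ X, R.pol (x₁, y) = R.pol (x₂, y))

/-- `R'` is the biclique reduction of `R` with respect to some coherent biclique. -/
def BicliqueStep (R R' : PRN) : Prop :=
  ∃ (X Y : Finset ℕ) (z : ℕ),
    CoherentBiclique R X Y ∧
    z ∉ R.base ∪ R.aux ∧
    R'.base = R.base ∧
    R'.aux = insert z R.aux ∧
    R'.edges = (R.edges \ (X ×ˢ Y)) ∪ (X ×ˢ ({z} : Finset ℕ)) ∪ (({z} : Finset ℕ) ×ˢ Y) ∧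
    (∀ y ∈ Y, y ∈ R.base → ∀ x ∈ X, R'.pol (z, y) = R.pol (x, y)) ∧
    (∀ e ∈ R.edges \ (X ×ˢ Y), e.2 ∈ R.base → R'.pol e = R.pol e)

/-- `R ↪* R'`: the reflexive transitive closure of biclique reduction. -/
def BicliqueChain : PRN → PRN → Prop := Relation.ReflTransGen BicliqueStep

/-- The total degree (in-degree plus out-degree) of a vertex in a PRN. -/
def totalDeg (R : PRN) (v : ℕ) : ℕ :=
  (R.edges.filter (fun e => e.1 = v)).card + (R.edges.filter (fun e => e.2 = v)).card

/-- The clauses `{x, y}` with `x ∈ X` and `y ∈ Y`. -/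
def pairClauses (X Y : Finset Lit) : Finset Clause :=
  (X ×ˢ Y).image fun p => {p.1, p.2}

lemma mem_pairClauses {X Y : Finset Lit} {C : Clause} :
    C ∈ pairClauses X Y ↔ ∃ x ∈ X, ∃ y ∈ Y, C = {x, y} := by
  simp only [pairClauses, Finset.mem_image, Finset.mem_product]
  constructor
  · rintro ⟨⟨a, b⟩, ⟨ha, hb⟩, rfl⟩
    exact ⟨a, ha, b, hb, rfl⟩
  · rintro ⟨a, ha, b, hb, rfl⟩
    exact ⟨(a, b), ⟨ha, hb⟩, rfl⟩

lemma joinClauses_image_singleton (X Y : Finset Lit) :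
    JoinClauses (X.image fun l => {l}) (Y.image fun l => {l}) = pairClauses X Y := by
  ext C
  simp only [JoinClauses, mem_pairClauses, Finset.mem_image, Finset.mem_product]
  constructor
  · rintro ⟨⟨_, _⟩, ⟨⟨a, ha, rfl⟩, b, hb, rfl⟩, rfl⟩
    exact ⟨a, ha, b, hb, rfl⟩
  · rintro ⟨a, ha, b, hb, rfl⟩
    exact ⟨(_, _), ⟨⟨a, ha, rfl⟩, b, hb, rfl⟩, rfl⟩

lemma image_insert_image_singleton (X : Finset Lit) (l : Lit) :
    (X.image fun x => ({x} : Clause)).image (fun C => insert l C) = pairClauses X {l} := by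
  ext C
  simp only [mem_pairClauses, Finset.mem_image, Finset.mem_singleton]
  constructor
  · rintro ⟨_, ⟨a, ha, rfl⟩, rfl⟩
    exact ⟨a, ha, l, rfl, Finset.pair_comm _ _⟩
  · rintro ⟨a, ha, _, rfl, rfl⟩
    exact ⟨_, ⟨a, ha, rfl⟩, Finset.pair_comm _ _⟩

lemma isClause_singleton (l : Lit) : IsClause {l} := by
  rintro v ⟨h, h'⟩
  rw [Finset.mem_singleton] at h h'
  simpa using h.trans h'.symm

/-- The clauses introduced by replacing the biclique `X, Y` through the variable `y`. -/
def newClauses (X Y : Finset Lit) (y : ℕ) : Finset Clause :=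
  pairClauses X {(y, true)} ∪ pairClauses Y {(y, false)}

lemma bvaStep_pairClauses {φ : Formula} {X Y : Finset Lit} {y : ℕ}
    (hsub : pairClauses X Y ⊆ φ) (hy : y ∉ Vars φ) :
    BVAStep φ ((φ \ pairClauses X Y) ∪ newClauses X Y y) := by
  refine ⟨X.image fun l => {l}, Y.image fun l => {l}, y, ?_, ?_, ?_, hy, ?_⟩
  · simp only [Finset.mem_image]
    rintro _ ⟨l, -, rfl⟩
    exact ⟨isClause_singleton l, Finset.singleton_nonempty l⟩
  · simp only [Finset.mem_image]
    rintro _ ⟨l, -, rfl⟩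
    exact ⟨isClause_singleton l, Finset.singleton_nonempty l⟩
  · rwa [joinClauses_image_singleton]
  · rw [joinClauses_image_singleton, image_insert_image_singleton, image_insert_image_singleton,
      newClauses, Finset.union_assoc]

lemma mem_newClauses {X Y : Finset Lit} {y : ℕ} {C : Clause} :
    C ∈ newClauses X Y y ↔
      (∃ l ∈ X, C = {l, (y, true)}) ∨ ∃ l ∈ Y, C = {l, (y, false)} := by
  simp [newClauses, mem_pairClauses]

lemma mem_vars {φ : Formula} {v : ℕ} : v ∈ Vars φ ↔ ∃ C ∈ φ, ∃ l ∈ C, l.1 = v := by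
  simp [Vars]

lemma mem_vars_of_mem {φ : Formula} {C : Clause} {l : Lit} (hC : C ∈ φ) (hl : l ∈ C) :
    l.1 ∈ Vars φ :=
  mem_vars.2 ⟨C, hC, l, hl, rfl⟩

/-- The result of replacing the bicliques `X i, Y i` for `i ∈ I` through the variables `f i`. -/
def reduceAll {ι : Type*} (φ : Formula) (I : Finset ι) (X Y : ι → Finset Lit) (f : ι → ℕ) :
    Formula :=
  (φ \ I.biUnion fun i => pairClauses (X i) (Y i)) ∪
    I.biUnion fun i => newClauses (X i) (Y i) (f i)

section ReduceAll

variable {ι : Type*} {φ : Formula} {I : Finset ι} {X Y : ι → Finset Lit} {f : ι → ℕ}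
  {V : Finset ℕ}

lemma mem_reduceAll {C : Clause} : C ∈ reduceAll φ I X Y f ↔
    (C ∈ φ ∧ ∀ i ∈ I, C ∉ pairClauses (X i) (Y i)) ∨
      ∃ i ∈ I, C ∈ newClauses (X i) (Y i) (f i) := by
  simp [reduceAll]

lemma vars_reduceAll_subset (hV : Vars φ ⊆ V) (hX : ∀ i ∈ I, ∀ l ∈ X i, l.1 ∈ V)
    (hY : ∀ i ∈ I, ∀ l ∈ Y i, l.1 ∈ V) :
    Vars (reduceAll φ I X Y f) ⊆ V ∪ I.image f := by
  intro v hv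
  obtain ⟨C, hC, l, hl, rfl⟩ := mem_vars.1 hv
  rw [Finset.mem_union]
  rcases mem_reduceAll.1 hC with ⟨hC, -⟩ | ⟨i, hi, hC⟩
  · exact Or.inl (hV (mem_vars_of_mem hC hl))
  · rcases mem_newClauses.1 hC with ⟨x, hx, rfl⟩ | ⟨x, hx, rfl⟩
    · rw [Finset.mem_insert, Finset.mem_singleton] at hl
      rcases hl with rfl | rfl
      · exact Or.inl (hX i hi _ hx)
      · exact Or.inr (Finset.mem_image_of_mem f hi)
    · rw [Finset.mem_insert, Finset.mem_singleton] at hl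
      rcases hl with rfl | rfl
      · exact Or.inl (hY i hi _ hx)
      · exact Or.inr (Finset.mem_image_of_mem f hi)

lemma isClause_pair_of_ne {l m : Lit} (h : l.1 ≠ m.1) :
    IsClause {l, m} ∧ ({l, m} : Clause).card = 2 := by
  refine ⟨?_, Finset.card_pair fun e => h (congrArg _ e)⟩
  rintro v ⟨h₁, h₂⟩
  rw [Finset.mem_insert, Finset.mem_singleton] at h₁ h₂
  grind

lemma is2CNF_reduceAll (hφ : Is2CNF φ) (hX : ∀ i ∈ I, ∀ l ∈ X i, l.1 ∈ V)
    (hY : ∀ i ∈ I, ∀ l ∈ Y i, l.1 ∈ V) (hf : ∀ i, f i ∉ V) :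
    Is2CNF (reduceAll φ I X Y f) := by
  intro C hC
  rcases mem_reduceAll.1 hC with ⟨hC, -⟩ | ⟨i, hi, hC⟩
  · exact hφ C hC
  · rcases mem_newClauses.1 hC with ⟨x, hx, rfl⟩ | ⟨x, hx, rfl⟩
    · exact isClause_pair_of_ne fun e => hf i ((show x.1 = f i from e) ▸ hX i hi x hx)
    · exact isClause_pair_of_ne fun e => hf i ((show x.1 = f i from e) ▸ hY i hi x hx)

/-- Pairwise disjoint bicliques can be replaced one after the other. -/
lemma bvaChain_reduceAll (hV : Vars φ ⊆ V) (hX : ∀ i ∈ I, ∀ l ∈ X i, l.1 ∈ V)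
    (hY : ∀ i ∈ I, ∀ l ∈ Y i, l.1 ∈ V) (hf : ∀ i, f i ∉ V) (hinj : Function.Injective f)
    (hsub : ∀ i ∈ I, pairClauses (X i) (Y i) ⊆ φ)
    (hdisj : ∀ i ∈ I, ∀ j ∈ I, ∀ C ∈ pairClauses (X i) (Y i), C ∈ pairClauses (X j) (Y j) →
      i = j) :
    BVAChain φ (reduceAll φ I X Y f) := by
  classical
  induction I using Finset.induction_on with
  | empty =>
    have : reduceAll φ ∅ X Y f = φ := by simp [reduceAll]
    rw [this]
    exact Relation.ReflTransGen.refl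
  | insert a I ha ih =>
    have hX' : ∀ i ∈ I, ∀ l ∈ X i, l.1 ∈ V := fun i hi => hX i (Finset.mem_insert_of_mem hi)
    have hY' : ∀ i ∈ I, ∀ l ∈ Y i, l.1 ∈ V := fun i hi => hY i (Finset.mem_insert_of_mem hi)
    have haI := Finset.mem_insert_self a I
    refine (ih hX' hY' (fun i hi => hsub i (Finset.mem_insert_of_mem hi))
      fun i hi j hj => hdisj i (Finset.mem_insert_of_mem hi) j (Finset.mem_insert_of_mem hj)).tail ?_
    have hfresh : f a ∉ Vars (reduceAll φ I X Y f) := by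
      intro h
      rcases Finset.mem_union.1 (vars_reduceAll_subset hV hX' hY' h) with h | h
      · exact hf a h
      · obtain ⟨i, hi, hia⟩ := Finset.mem_image.1 h
        exact ha (hinj hia ▸ hi)
    have hsub' : pairClauses (X a) (Y a) ⊆ reduceAll φ I X Y f := by
      intro C hC
      refine mem_reduceAll.2 (Or.inl ⟨hsub a haI hC, fun i hi hCi => ha ?_⟩)
      exact hdisj a haI i (Finset.mem_insert_of_mem hi) C hC hCi ▸ hi
    have key := bvaStep_pairClauses hsub' hfresh
    convert key using 1
    ext C
    have hnew : ∀ i, C ∈ newClauses (X i) (Y i) (f i) → C ∉ pairClauses (X a) (Y a) := by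
      intro i hC hCa
      have hCφ := hsub a haI hCa
      rcases mem_newClauses.1 hC with ⟨l, -, rfl⟩ | ⟨l, -, rfl⟩
      · exact hf i (hV (mem_vars_of_mem hCφ (l := (f i, true)) (by simp)))
      · exact hf i (hV (mem_vars_of_mem hCφ (l := (f i, false)) (by simp)))
    simp only [Finset.mem_union, Finset.mem_sdiff, mem_reduceAll, Finset.forall_mem_insert,
      Finset.exists_mem_insert]
    constructor
    · rintro (⟨h1, h2, h3⟩ | h | ⟨i, hi, h⟩)
      · exact Or.inl ⟨Or.inl ⟨h1, h3⟩, h2⟩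
      · exact Or.inr h
      · exact Or.inl ⟨Or.inr ⟨i, hi, h⟩, hnew i h⟩
    · rintro (⟨⟨h1, h3⟩ | ⟨i, hi, h⟩, h2⟩ | h)
      · exact Or.inl ⟨h1, h2, h3⟩
      · exact Or.inr (Or.inr ⟨i, hi, h⟩)
      · exact Or.inr (Or.inl h)

end ReduceAll

lemma exists_injective_notMem (ι : Type*) [Encodable ι] (V : Finset ℕ) :
    ∃ f : ι → ℕ, Function.Injective f ∧ ∀ i, f i ∉ V := by
  refine ⟨fun i => V.sup id + 1 + Encodable.encode i, fun i j h => ?_, fun i h => ?_⟩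
  · exact Encodable.encode_injective (Nat.add_left_cancel h)
  · have := Finset.le_sup (f := id) h
    simp only [id] at this
    omega

/-- Every finite set splits into parts of size at most two, with at most one singleton part. -/
lemma exists_pairing (s : Finset ℕ) : ∃ P : Finset (Finset ℕ),
    (∀ p ∈ P, p ⊆ s ∧ ∃ a b, p = {a, b}) ∧ (∀ a ∈ s, ∃ p ∈ P, a ∈ p) ∧
    (∀ p ∈ P, ∀ q ∈ P, ∀ a ∈ p, a ∈ q → p = q) ∧ 2 * P.card ≤ s.card + 1 := by
  induction s using Finset.strongInduction with
  | H s ih =>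
    rcases s.eq_empty_or_nonempty with rfl | ⟨a, ha⟩
    · exact ⟨∅, by simp⟩
    rcases (s.erase a).eq_empty_or_nonempty with he | ⟨b, hb⟩
    · have hs : s = {a} := by rw [← Finset.insert_erase ha, he]; rfl
      subst hs
      exact ⟨{{a}}, by simpa using ⟨a, a, (Finset.pair_eq_singleton a).symm⟩⟩
    · obtain ⟨P, h1, h2, h3, h4⟩ := ih ((s.erase a).erase b)
        ((Finset.erase_subset _ _).trans_ssubset (Finset.erase_ssubset ha))
      have hba := Finset.mem_erase.1 hb
      have hcard : ((s.erase a).erase b).card + 2 = s.card := by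
        have e1 := Finset.card_erase_add_one ha
        have e2 := Finset.card_erase_add_one hb
        omega
      refine ⟨insert {a, b} P, ?_, ?_, ?_, ?_⟩
      · intro p hp
        rcases Finset.mem_insert.1 hp with rfl | hp
        · refine ⟨?_, a, b, rfl⟩
          intro x hx
          rw [Finset.mem_insert, Finset.mem_singleton] at hx
          rcases hx with rfl | rfl
          exacts [ha, hba.2]
        · exact ⟨(h1 p hp).1.trans ((Finset.erase_subset _ _).trans (Finset.erase_subset _ _)),
            (h1 p hp).2⟩
      · intro x hx
        by_cases hxa : x = a
        · exact ⟨_, Finset.mem_insert_self _ _, by simp [hxa]⟩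
        by_cases hxb : x = b
        · exact ⟨_, Finset.mem_insert_self _ _, by simp [hxb]⟩
        obtain ⟨p, hp, hxp⟩ := h2 x (by simp [hx, hxa, hxb])
        exact ⟨p, Finset.mem_insert_of_mem hp, hxp⟩
      · have hab : ∀ q ∈ P, ∀ x ∈ q, x ∉ ({a, b} : Finset ℕ) := by
          intro q hq x hx hxab
          have := (h1 q hq).1 hx
          simp at this hxab
          tauto
        intro p hp q hq x hxp hxq
        rcases Finset.mem_insert.1 hp with rfl | hp <;>
          rcases Finset.mem_insert.1 hq with rfl | hq
        · rfl
        · exact absurd hxp (hab q hq x hxq)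
        · exact absurd hxq (hab p hp x hxp)
        · exact h3 p hp q hq x hxp hxq
      · have := Finset.card_insert_le {a, b} P
        omega


lemma exists_eq_pair_of_isSimple {φ : Formula} (h2 : Is2CNF φ) (hs : IsSimple φ) {C : Clause}
    (hC : C ∈ φ) : ∃ u v b, C = {(u, false), (v, b)} ∧ u ≠ v := by
  obtain ⟨⟨u, p⟩, hl, hneg⟩ := hs.2.1 C hC
  obtain rfl : p = false := hneg
  obtain ⟨hcl, hcard⟩ := h2 C hC
  obtain ⟨⟨v, b⟩, hv⟩ := Finset.card_eq_one.1
    (show (C.erase (u, false)).card = 1 by rw [Finset.card_erase_of_mem hl, hcard])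
  have hCeq : C = {(u, false), (v, b)} := by rw [← Finset.insert_erase hl, hv]
  refine ⟨u, v, b, hCeq, ?_⟩
  rintro rfl
  cases b
  · rw [hCeq] at hcard
    simp at hcard
  · exact hcl u ⟨by simp [hCeq], hl⟩

/-- The implication `u → v` between variables given by a clause `¬u ∨ v`. -/
def ImpEdge (φ : Formula) (u v : ℕ) : Prop := u ≠ v ∧ ({(u, false), (v, true)} : Clause) ∈ φ

lemma ImpEdge.imp {φ : Formula} {u v : ℕ} (h : ImpEdge φ u v) {τ : ℕ → Bool}
    (hτ : Satisfies τ φ) (hu : τ u = true) : τ v = true := by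
  obtain ⟨l, hl, ht⟩ := hτ _ h.2
  rw [Finset.mem_insert, Finset.mem_singleton] at hl
  rcases hl with rfl | rfl
  · simp [LitTrue, hu] at ht
  · exact ht

lemma imp_of_reflTransGen {φ : Formula} {u v : ℕ} (h : Relation.ReflTransGen (ImpEdge φ) u v)
    {τ : ℕ → Bool} (hτ : Satisfies τ φ) (hu : τ u = true) : τ v = true := by
  induction h with
  | refl => exact hu
  | tail _ hbc ih => exact hbc.imp hτ ih

lemma reflTransGen_impEdge_antisymm {φ : Formula} (hs : IsSimple φ) {u v : ℕ}
    (h : Relation.ReflTransGen (ImpEdge φ) u v) (h' : Relation.ReflTransGen (ImpEdge φ) v u) :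
    u = v := by
  by_contra hne
  exact hs.1 (u, true) (v, true) (fun e => hne (congrArg Prod.fst e)) fun τ hτ =>
    ⟨imp_of_reflTransGen h hτ, imp_of_reflTransGen h' hτ⟩

/-- A simple formula has a topological ranking of its variables. -/
lemma exists_rank {φ : Formula} (h2 : Is2CNF φ) (hs : IsSimple φ) :
    ∃ r : ℕ → ℕ, Set.InjOn r (Vars φ) ∧ (∀ v ∈ Vars φ, r v < (Vars φ).card) ∧
      ∀ C ∈ φ, ∃ u ∈ Vars φ, ∃ v ∈ Vars φ, ∃ b, C = {(u, false), (v, b)} ∧ r u < r v := by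
  classical
  have : IsPartialOrder ℕ (Relation.ReflTransGen (ImpEdge φ)) :=
    { refl := fun _ => Relation.ReflTransGen.refl
      trans := fun _ _ _ => Relation.ReflTransGen.trans
      antisymm := fun _ _ => reflTransGen_impEdge_antisymm hs }
  obtain ⟨s, hlin, hle⟩ := extend_partialOrder (Relation.ReflTransGen (ImpEdge φ))
  have hrefl : ∀ a, s a a := fun a => hle _ _ Relation.ReflTransGen.refl
  have htrans : ∀ a b c, s a b → s b c → s a c := fun a b c => hlin.trans a b c
  have hanti : ∀ a b, s a b → s b a → a = b := fun a b => hlin.antisymm a b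
  have htot : ∀ a b, s a b ∨ s b a := fun a b => hlin.total a b
  set r : ℕ → ℕ := fun v => ((Vars φ).filter fun w => s w v ∧ w ≠ v).card with hr
  have hmono : ∀ u ∈ Vars φ, ∀ v, s u v → u ≠ v → r u < r v := by
    intro u hu v huv hne
    refine Finset.card_lt_card ⟨fun w hw => ?_, fun h => ?_⟩
    · simp only [Finset.mem_filter] at hw ⊢
      refine ⟨hw.1, htrans _ _ _ hw.2.1 huv, ?_⟩
      rintro rfl
      exact hne (hanti _ _ huv hw.2.1)
    · have := h (Finset.mem_filter.2 ⟨hu, huv, hne⟩)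
      simp at this
  refine ⟨r, ?_, ?_, ?_⟩
  · intro u hu v hv huv
    by_contra hne
    rcases htot u v with h | h
    · exact (hmono u hu v h hne).ne huv
    · exact (hmono v hv u h (Ne.symm hne)).ne huv.symm
  · intro v hv
    refine Finset.card_lt_card ⟨Finset.filter_subset _ _, fun h => ?_⟩
    have := h hv
    simp at this
  · intro C hC
    obtain ⟨u, v, b, rfl, hne⟩ := exists_eq_pair_of_isSimple h2 hs hC
    have hu : u ∈ Vars φ := mem_vars_of_mem hC (l := (u, false)) (by simp)
    have hv : v ∈ Vars φ := mem_vars_of_mem hC (l := (v, b)) (by simp)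
    cases b
    · rcases htot u v with h | h
      · exact ⟨u, hu, v, hv, false, rfl, hmono u hu v h hne⟩
      · exact ⟨v, hv, u, hu, false, Finset.pair_comm _ _, hmono v hv u h hne.symm⟩
    · exact ⟨u, hu, v, hv, true, rfl,
        hmono u hu v (hle _ _ (Relation.ReflTransGen.single ⟨hne, hC⟩)) hne⟩

/-- The literals `l` over the `h`-th block of `B` ranks with `¬u ∨ l` in the formula. -/
def blockPattern (φ : Formula) (r : ℕ → ℕ) (B u h : ℕ) : Finset Lit :=
  (Vars φ ×ˢ Finset.univ).filter fun l => r l.1 / B = h ∧ ({(u, false), l} : Clause) ∈ φ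

lemma mem_blockPattern {φ : Formula} {r : ℕ → ℕ} {B u h : ℕ} {l : Lit} :
    l ∈ blockPattern φ r B u h ↔
      l.1 ∈ Vars φ ∧ r l.1 / B = h ∧ ({(u, false), l} : Clause) ∈ φ := by
  simp [blockPattern]

lemma card_block_le {V : Finset ℕ} {r : ℕ → ℕ} (hr : Set.InjOn r V) {B : ℕ} (hB : 0 < B)
    (h : ℕ) : (V.filter fun v => r v / B = h).card ≤ B := by
  have : (V.filter fun v => r v / B = h).card ≤ (Finset.Ico (h * B) (h * B + B)).card := by
    refine Finset.card_le_card_of_injOn r (fun v hv => ?_) (hr.mono fun v hv => (Finset.mem_filter.1 hv).1)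
    have hv' := (Finset.mem_filter.1 hv).2
    have := (Nat.div_eq_iff hB).1 hv'
    simp only [Finset.coe_Ico, Set.mem_Ico]
    omega
  simpa using this

lemma card_literals_le {V : Finset ℕ} {r : ℕ → ℕ} (hr : Set.InjOn r V) {B : ℕ} (hB : 0 < B)
    (h : ℕ) {L : Finset Lit} (hL : ∀ l ∈ L, l.1 ∈ V ∧ r l.1 / B = h) : L.card ≤ B * 2 := by
  calc L.card ≤ ((V.filter fun v => r v / B = h) ×ˢ (Finset.univ : Finset Bool)).card :=
        Finset.card_le_card fun l hl => by simpa using hL l hl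
    _ ≤ B * 2 := by
        rw [Finset.card_product]
        exact Nat.mul_le_mul (card_block_le hr hB h) (by simp)

lemma card_image_blockPattern_le {φ : Formula} (h2 : Is2CNF φ) (hs : IsSimple φ) {r : ℕ → ℕ}
    (hr : Set.InjOn r (Vars φ)) {B : ℕ} (hB : 0 < B) (h : ℕ) (U : Finset ℕ) :
    (U.image fun u => blockPattern φ r B u h).card ≤ 3 ^ B := by
  classical
  set W := (Vars φ).filter fun v => r v / B = h with hW
  let F : (W → Option Bool) → Finset Lit := fun o =>
    (Vars φ ×ˢ Finset.univ).filter fun l => ∃ hl : l.1 ∈ W, o ⟨l.1, hl⟩ = some l.2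
  have hsub : (U.image fun u => blockPattern φ r B u h) ⊆ Finset.univ.image F := by
    intro T hT
    obtain ⟨u, -, rfl⟩ := Finset.mem_image.1 hT
    refine Finset.mem_image.2 ⟨fun w =>
      if ({(u, false), (w.1, true)} : Clause) ∈ φ then some true else
      if ({(u, false), (w.1, false)} : Clause) ∈ φ then some false else none,
      Finset.mem_univ _, ?_⟩
    ext ⟨v, b⟩
    have hexcl : ({(u, false), (v, true)} : Clause) ∈ φ →
        ({(u, false), (v, false)} : Clause) ∈ φ → False := by
      intro h1 h1'
      have heq := hs.2.2 _ h1 _ h1' (by simp)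
      have hmem : (v, false) ∈ ({(u, false), (v, true)} : Clause) := by simp [heq]
      exact (h2 _ h1).1 v ⟨by simp, hmem⟩
    simp only [F, Finset.mem_filter, Finset.mem_product, Finset.mem_univ, and_true,
      mem_blockPattern, hW]
    cases b <;> grind
  calc _ ≤ (Finset.univ.image F).card := Finset.card_le_card hsub
    _ ≤ Fintype.card (W → Option Bool) := Finset.card_image_le
    _ = 3 ^ W.card := by simp
    _ ≤ 3 ^ B := Nat.pow_le_pow_right (by norm_num) (card_block_le hr hB h)

lemma pair_eq_pair {u u' : ℕ} {l l' : Lit}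
    (h : ({(u, false), l} : Clause) = {(u', false), l'}) :
    u = u' ∧ l = l' ∨ l = (u', false) ∧ l' = (u, false) := by
  have h' := congrArg (fun s : Clause => (s : Set Lit)) h
  simp only [Finset.coe_pair, Set.pair_eq_pair_iff] at h'
  grind

lemma card_pairClauses_singleton_le (X : Finset Lit) (l : Lit) :
    (pairClauses X {l}).card ≤ X.card :=
  Finset.card_image_le.trans (by simp)

/-- Two rounds of biclique replacements: first the rows of equal patterns in each block of `B`
ranks, then pairs of rows lying in the same group of `A` ranks. -/
theorem exists_bvaChain_card_le {φ : Formula} (h2 : Is2CNF φ) (hs : IsSimple φ) {A B m : ℕ}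
    (hA : 0 < A) (hB : 0 < B) (hm : (Vars φ).card = m) :
    ∃ φ' : Formula, Is2CNF φ' ∧ BVAChain φ φ' ∧
      2 * φ'.card ≤ 2 * (m * (B * 2) + (m / B + 1) * 3 ^ B * (B * 2) + m * A * 2) +
        (∑ h ∈ Finset.range (m / B + 1), h * B) + (m / B + 1) * 3 ^ B * (m / A + 1) := by
  classical
  obtain ⟨r, hinj, hlt, hcl⟩ := exists_rank h2 hs
  rw [hm] at hlt
  set V := Vars φ with hV
  set K := m / B + 1 with hK
  set G := m / A + 1 with hG
  set D := (Finset.range K ×ˢ V).filter fun q => r q.2 / B < q.1 with hD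
  set I₁ := D.image fun q => (q.1, blockPattern φ r B q.2 q.1) with hI₁
  let rows : ℕ × Finset Lit → Finset ℕ := fun i =>
    V.filter fun u => r u / B < i.1 ∧ blockPattern φ r B u i.1 = i.2
  let X₁ : ℕ × Finset Lit → Finset Lit := fun i => (rows i).image fun u => (u, false)
  let Y₁ : ℕ × Finset Lit → Finset Lit := fun i => i.2
  let grp : ℕ × Finset Lit → ℕ → Finset ℕ := fun i g => (rows i).filter fun u => r u / A = g
  have mem_rows : ∀ i u, u ∈ rows i ↔
      u ∈ V ∧ r u / B < i.1 ∧ blockPattern φ r B u i.1 = i.2 := by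
    intro i u
    simp [rows]
  have mem_grp : ∀ i g u, u ∈ grp i g ↔ u ∈ rows i ∧ r u / A = g := by
    intro i g u
    simp [grp]
  have mem_X₁ : ∀ i l, l ∈ X₁ i ↔ ∃ u ∈ rows i, l = (u, false) := by
    intro i l
    simp only [X₁, Finset.mem_image, eq_comm]
  have lt_K : ∀ v ∈ V, r v / B < K := fun v hv =>
    Nat.lt_succ_of_le (Nat.div_le_div_right (hlt v hv).le)
  have lt_G : ∀ v ∈ V, r v / A < G := fun v hv =>
    Nat.lt_succ_of_le (Nat.div_le_div_right (hlt v hv).le)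
  have mem_I₁ : ∀ u ∈ V, ∀ h < K, r u / B < h → (h, blockPattern φ r B u h) ∈ I₁ := by
    intro u hu h hh hlt
    exact Finset.mem_image.2 ⟨(h, u), by simp [hD, hu, hh, hlt], rfl⟩
  have pat_of_I₁ : ∀ i ∈ I₁, ∃ u, i.2 = blockPattern φ r B u i.1 := by
    intro i hi
    obtain ⟨q, -, rfl⟩ := Finset.mem_image.1 hi
    exact ⟨q.2, rfl⟩
  -- The first round.
  obtain ⟨f₁, f₁_inj, hf₁⟩ := exists_injective_notMem (ℕ × Finset Lit) V
  have hX₁ : ∀ i ∈ I₁, ∀ l ∈ X₁ i, l.1 ∈ V := by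
    intro i _ l hl
    obtain ⟨u, hu, rfl⟩ := (mem_X₁ i l).1 hl
    exact ((mem_rows i u).1 hu).1
  have hY₁ : ∀ i ∈ I₁, ∀ l ∈ Y₁ i, l.1 ∈ V := by
    intro i hi l hl
    obtain ⟨u, hu⟩ := pat_of_I₁ i hi
    exact (mem_blockPattern.1 (hu ▸ hl : l ∈ blockPattern φ r B u i.1)).1
  have mem_J₁ : ∀ i C, C ∈ pairClauses (X₁ i) (Y₁ i) → ∃ u ∈ rows i,
      ∃ l ∈ blockPattern φ r B u i.1, C = {(u, false), l} := by
    intro i C hC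
    obtain ⟨x, hx, l, hl, rfl⟩ := mem_pairClauses.1 hC
    obtain ⟨u, hu, rfl⟩ := (mem_X₁ i x).1 hx
    exact ⟨u, hu, l, ((mem_rows i u).1 hu).2.2 ▸ hl, rfl⟩
  have hsub₁ : ∀ i ∈ I₁, pairClauses (X₁ i) (Y₁ i) ⊆ φ := by
    intro i _ C hC
    obtain ⟨u, _, l, hl, rfl⟩ := mem_J₁ i C hC
    exact (mem_blockPattern.1 hl).2.2
  have hdisj₁ : ∀ i ∈ I₁, ∀ j ∈ I₁, ∀ C ∈ pairClauses (X₁ i) (Y₁ i),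
      C ∈ pairClauses (X₁ j) (Y₁ j) → i = j := by
    intro i _ j _ C hCi hCj
    obtain ⟨u, hu, l, hl, rfl⟩ := mem_J₁ i C hCi
    obtain ⟨u', hu', l', hl', heq⟩ := mem_J₁ j _ hCj
    have hu := ((mem_rows i u).1 hu).2
    have hu' := ((mem_rows j u').1 hu').2
    have hb := (mem_blockPattern.1 hl).2.1
    have hb' := (mem_blockPattern.1 hl').2.1
    rcases pair_eq_pair heq with ⟨rfl, rfl⟩ | ⟨rfl, rfl⟩
    · have h1 : i.1 = j.1 := hb.symm.trans hb'
      refine Prod.ext h1 ?_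
      rw [← hu.2, ← hu'.2, h1]
    · simp only at hb hb'
      omega
  have chain₁ := bvaChain_reduceAll (V := V) subset_rfl hX₁ hY₁ hf₁ f₁_inj hsub₁ hdisj₁
  have cnf₁ := is2CNF_reduceAll h2 hX₁ hY₁ hf₁
  have vars₁ := vars_reduceAll_subset (f := f₁) (V := V) subset_rfl hX₁ hY₁
  set φ₁ := reduceAll φ I₁ X₁ Y₁ f₁ with hφ₁
  set V₁ := V ∪ I₁.image f₁ with hV₁
  -- The second round.
  choose P hP_sub hP_cover hP_disj hP_card using exists_pairing
  set I₂ := I₁.biUnion fun i => (Finset.range G).biUnion fun g => P (grp i g) with hI₂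
  let X₂ : Finset ℕ → Finset Lit := fun S => S.image fun u => (u, false)
  let Y₂ : Finset ℕ → Finset Lit := fun S =>
    (I₁.filter fun i => ∃ g, g < G ∧ S ∈ P (grp i g)).image fun i => (f₁ i, true)
  have mem_I₂ : ∀ S, S ∈ I₂ ↔ ∃ i ∈ I₁, ∃ g, g < G ∧ S ∈ P (grp i g) := by
    intro S
    simp [hI₂]
  have mem_X₂ : ∀ S l, l ∈ X₂ S ↔ ∃ u ∈ S, l = (u, false) := by
    intro S l
    simp only [X₂, Finset.mem_image, eq_comm]
  have mem_Y₂ : ∀ S l, l ∈ Y₂ S ↔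
      ∃ i ∈ I₁, (∃ g, g < G ∧ S ∈ P (grp i g)) ∧ l = (f₁ i, true) := by
    intro S l
    simp only [Y₂, Finset.mem_image, Finset.mem_filter, eq_comm, and_assoc]
  obtain ⟨f₂, f₂_inj, hf₂⟩ := exists_injective_notMem (Finset ℕ) V₁
  have hX₂ : ∀ S ∈ I₂, ∀ l ∈ X₂ S, l.1 ∈ V₁ := by
    intro S hS l hl
    obtain ⟨u, hu, rfl⟩ := (mem_X₂ S l).1 hl
    obtain ⟨i, _, g, _, hSP⟩ := (mem_I₂ S).1 hS
    have := (mem_grp i g u).1 ((hP_sub _ S hSP).1 hu)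
    exact Finset.mem_union_left _ ((mem_rows i u).1 this.1).1
  have hY₂ : ∀ S ∈ I₂, ∀ l ∈ Y₂ S, l.1 ∈ V₁ := by
    intro S _ l hl
    obtain ⟨i, hi, _, rfl⟩ := (mem_Y₂ S l).1 hl
    exact Finset.mem_union_right _ (Finset.mem_image_of_mem f₁ hi)
  have mem_J₂ : ∀ S C, C ∈ pairClauses (X₂ S) (Y₂ S) → ∃ u ∈ S, ∃ i ∈ I₁,
      ∃ g, g < G ∧ S ∈ P (grp i g) ∧ C = {(u, false), (f₁ i, true)} := by
    intro S C hC
    obtain ⟨x, hx, l, hl, rfl⟩ := mem_pairClauses.1 hC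
    obtain ⟨u, hu, rfl⟩ := (mem_X₂ S x).1 hx
    obtain ⟨i, hi, ⟨g, hg, hSP⟩, rfl⟩ := (mem_Y₂ S l).1 hl
    exact ⟨u, hu, i, hi, g, hg, hSP, rfl⟩
  have hsub₂ : ∀ S ∈ I₂, pairClauses (X₂ S) (Y₂ S) ⊆ φ₁ := by
    intro S _ C hC
    obtain ⟨u, hu, i, hi, g, _, hSP, rfl⟩ := mem_J₂ S C hC
    have hu := (mem_grp i g u).1 ((hP_sub _ S hSP).1 hu)
    exact mem_reduceAll.2 (Or.inr ⟨i, hi,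
      mem_newClauses.2 (Or.inl ⟨_, (mem_X₁ i _).2 ⟨u, hu.1, rfl⟩, rfl⟩)⟩)
  have hdisj₂ : ∀ S ∈ I₂, ∀ S' ∈ I₂, ∀ C ∈ pairClauses (X₂ S) (Y₂ S),
      C ∈ pairClauses (X₂ S') (Y₂ S') → S = S' := by
    intro S _ S' _ C hC hC'
    obtain ⟨u, hu, i, _, g, _, hSP, rfl⟩ := mem_J₂ S C hC
    obtain ⟨u', hu', i', _, g', _, hSP', heq⟩ := mem_J₂ S' _ hC'
    have hg := ((mem_grp i g u).1 ((hP_sub _ S hSP).1 hu)).2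
    have hg' := ((mem_grp i' g' u').1 ((hP_sub _ S' hSP').1 hu')).2
    rcases pair_eq_pair heq with ⟨rfl, hi⟩ | ⟨h, -⟩
    · obtain rfl : i = i' := f₁_inj (congrArg Prod.fst hi)
      obtain rfl : g = g' := hg.symm.trans hg'
      exact hP_disj _ S hSP S' hSP' u hu hu'
    · simp at h
  have chain₂ := bvaChain_reduceAll (V := V₁) vars₁ hX₂ hY₂ hf₂ f₂_inj hsub₂ hdisj₂
  have cnf₂ := is2CNF_reduceAll cnf₁ hX₂ hY₂ hf₂
  refine ⟨_, cnf₂, chain₁.trans chain₂, ?_⟩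
  set φ₂ := reduceAll φ₁ I₂ X₂ Y₂ f₂ with hφ₂
  -- The clauses of the final formula.
  set Q₀ := V.biUnion fun u => ((V ×ˢ (Finset.univ : Finset Bool)).filter
    fun l => r l.1 / B = r u / B).image fun l => ({(u, false), l} : Clause) with hQ₀
  set Q₁ := I₁.biUnion fun i => pairClauses i.2 {(f₁ i, false)} with hQ₁
  set Q₂ := I₂.biUnion fun S => pairClauses (X₂ S) {(f₂ S, true)} with hQ₂
  set Q₃ := (I₁ ×ˢ Finset.range G).biUnion fun q => (P (grp q.1 q.2)).image
    fun S => ({(f₁ q.1, true), (f₂ S, false)} : Clause) with hQ₃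
  have hcover : φ₂ ⊆ Q₀ ∪ Q₁ ∪ Q₂ ∪ Q₃ := by
    intro C hC
    simp only [Finset.mem_union]
    rcases mem_reduceAll.1 hC with ⟨hC, hC₂⟩ | ⟨S, hS, hC⟩
    · rcases mem_reduceAll.1 hC with ⟨hC, hC₁⟩ | ⟨i, hi, hC⟩
      · obtain ⟨u, hu, v, hv, b, rfl, huv⟩ := hcl C hC
        rcases (Nat.div_le_div_right (c := B) huv.le).lt_or_eq with h | h
        · refine absurd ?_ (hC₁ _ (mem_I₁ u hu (r v / B) (lt_K v hv) h))
          refine mem_pairClauses.2 ⟨(u, false), (mem_X₁ _ _).2 ⟨u, (mem_rows _ _).2 ⟨hu, h, rfl⟩,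
            rfl⟩, (v, b), mem_blockPattern.2 ⟨hv, rfl, hC⟩, rfl⟩
        · refine Or.inl (Or.inl (Or.inl (Finset.mem_biUnion.2 ⟨u, hu, Finset.mem_image.2
            ⟨(v, b), ?_, rfl⟩⟩)))
          simp [hv, h]
      · rcases mem_newClauses.1 hC with ⟨x, hx, rfl⟩ | ⟨l, hl, rfl⟩
        · obtain ⟨u, hu, rfl⟩ := (mem_X₁ i x).1 hx
          have huV := ((mem_rows i u).1 hu).1
          obtain ⟨S, hS, huS⟩ := hP_cover (grp i (r u / A)) u ((mem_grp _ _ _).2 ⟨hu, rfl⟩)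
          have hex : ∃ g, g < G ∧ S ∈ P (grp i g) := ⟨_, lt_G u huV, hS⟩
          exact absurd (mem_pairClauses.2 ⟨_, (mem_X₂ S _).2 ⟨u, huS, rfl⟩, _,
            (mem_Y₂ S _).2 ⟨i, hi, hex, rfl⟩, rfl⟩) (hC₂ S ((mem_I₂ S).2 ⟨i, hi, hex⟩))
        · exact Or.inl (Or.inl (Or.inr (Finset.mem_biUnion.2 ⟨i, hi,
            mem_pairClauses.2 ⟨l, hl, _, Finset.mem_singleton_self _, rfl⟩⟩)))
    · rcases mem_newClauses.1 hC with ⟨x, hx, rfl⟩ | ⟨l, hl, rfl⟩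
      · exact Or.inl (Or.inr (Finset.mem_biUnion.2 ⟨S, hS,
            mem_pairClauses.2 ⟨x, hx, _, Finset.mem_singleton_self _, rfl⟩⟩))
      · obtain ⟨i, hi, ⟨g, hg, hSP⟩, rfl⟩ := (mem_Y₂ S l).1 hl
        exact Or.inr (Finset.mem_biUnion.2 ⟨(i, g),
          Finset.mem_product.2 ⟨hi, Finset.mem_range.2 hg⟩, Finset.mem_image.2 ⟨S, hSP, rfl⟩⟩)
  -- Counting.
  have card_I₁ : I₁.card ≤ K * 3 ^ B := by
    have : I₁ ⊆ (Finset.range K).biUnion fun h =>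
        (V.image fun u => blockPattern φ r B u h).image fun T => (h, T) := by
      intro i hi
      obtain ⟨⟨h, u⟩, hq, rfl⟩ := Finset.mem_image.1 hi
      have hq' := Finset.mem_product.1 (Finset.mem_filter.1 hq).1
      exact Finset.mem_biUnion.2 ⟨h, hq'.1,
        Finset.mem_image_of_mem _ (Finset.mem_image_of_mem _ hq'.2)⟩
    refine (Finset.card_le_card this).trans ?_
    refine (Finset.card_biUnion_le_card_mul _ _ (3 ^ B) fun h _ => ?_).trans (by simp)
    exact Finset.card_image_le.trans (card_image_blockPattern_le h2 hs hinj hB h V)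
  have card_Q₀ : Q₀.card ≤ m * (B * 2) := by
    rw [← hm]
    refine Finset.card_biUnion_le_card_mul _ _ _ fun u _ => Finset.card_image_le.trans ?_
    exact card_literals_le hinj hB (r u / B) fun l hl => by simpa using hl
  have card_Q₁ : Q₁.card ≤ K * 3 ^ B * (B * 2) := by
    refine (Finset.card_biUnion_le_card_mul _ _ (B * 2) fun i hi => ?_).trans
      (Nat.mul_le_mul_right _ card_I₁)
    refine (card_pairClauses_singleton_le _ _).trans (card_literals_le hinj hB i.1 fun l hl => ?_)
    obtain ⟨u, hu⟩ := pat_of_I₁ i hi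
    rw [hu, mem_blockPattern] at hl
    exact ⟨hl.1, hl.2.1⟩
  have card_I₂ : I₂.card ≤ m * A := by
    have : I₂ ⊆ V.biUnion fun u => (V.filter fun v => r v / A = r u / A).image
        fun v => ({u, v} : Finset ℕ) := by
      intro S hS
      obtain ⟨i, _, g, _, hSP⟩ := (mem_I₂ S).1 hS
      obtain ⟨hsub, a, b, rfl⟩ := hP_sub _ S hSP
      have ha := (mem_grp i g a).1 (hsub (by simp))
      have hb := (mem_grp i g b).1 (hsub (by simp))
      exact Finset.mem_biUnion.2 ⟨a, ((mem_rows i a).1 ha.1).1, Finset.mem_image.2 ⟨b,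
        Finset.mem_filter.2 ⟨((mem_rows i b).1 hb.1).1, hb.2.trans ha.2.symm⟩, rfl⟩⟩
    refine (Finset.card_le_card this).trans ?_
    rw [← hm]
    exact Finset.card_biUnion_le_card_mul _ _ _ fun u _ =>
      Finset.card_image_le.trans (card_block_le hinj hA _)
  have card_Q₂ : Q₂.card ≤ m * A * 2 := by
    refine (Finset.card_biUnion_le_card_mul _ _ 2 fun S hS => ?_).trans
      (Nat.mul_le_mul_right _ card_I₂)
    refine (card_pairClauses_singleton_le _ _).trans (Finset.card_image_le.trans ?_)
    obtain ⟨i, _, g, _, hSP⟩ := (mem_I₂ S).1 hS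
    obtain ⟨_, a, b, rfl⟩ := hP_sub _ S hSP
    exact Finset.card_le_two
  have card_D : D.card ≤ ∑ h ∈ Finset.range K, h * B := by
    rw [Finset.card_eq_sum_card_fiberwise (f := Prod.fst) (t := Finset.range K)
      (fun q hq => (Finset.mem_product.1 (Finset.mem_filter.1 hq).1).1)]
    refine Finset.sum_le_sum fun h _ => ?_
    have : (D.filter fun q => q.1 = h).card ≤ (Finset.range (h * B)).card := by
      refine Finset.card_le_card_of_injOn (fun q => r q.2) ?_ ?_
      · rintro ⟨h', u⟩ hq
        obtain ⟨hqD, rfl⟩ := Finset.mem_filter.1 hq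
        exact Finset.mem_coe.2 (Finset.mem_range.2
          ((Nat.div_lt_iff_lt_mul hB).1 (Finset.mem_filter.1 hqD).2))
      · rintro ⟨h', u⟩ hq ⟨h'', u'⟩ hq' heq
        obtain ⟨hqD, rfl⟩ := Finset.mem_filter.1 hq
        obtain ⟨hqD', hh⟩ := Finset.mem_filter.1 hq'
        exact Prod.ext hh.symm (hinj (Finset.mem_product.1 (Finset.mem_filter.1 hqD).1).2
          (Finset.mem_product.1 (Finset.mem_filter.1 hqD').1).2 heq)
    simpa using this
  have sum_grp : ∑ q ∈ I₁ ×ˢ Finset.range G, (grp q.1 q.2).card ≤ D.card := by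
    rw [Finset.card_eq_sum_card_fiberwise (s := D) (t := I₁ ×ˢ Finset.range G)
      (f := fun q => ((q.1, blockPattern φ r B q.2 q.1), r q.2 / A))]
    · refine Finset.sum_le_sum fun q hq => ?_
      refine Finset.card_le_card_of_injOn (fun u => (q.1.1, u)) ?_ ?_
      · intro u hu
        obtain ⟨hu, hg⟩ := (mem_grp _ _ _).1 hu
        obtain ⟨hu, hlt', hpat⟩ := (mem_rows _ _).1 hu
        obtain ⟨q', hq', hqq⟩ := Finset.mem_image.1 (Finset.mem_product.1 hq).1
        have hK' := (Finset.mem_product.1 (Finset.mem_filter.1 hq').1).1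
        have h1 : q'.1 = q.1.1 := congrArg Prod.fst hqq
        rw [h1] at hK'
        refine Finset.mem_coe.2 (Finset.mem_filter.2 ⟨Finset.mem_filter.2
          ⟨Finset.mem_product.2 ⟨hK', hu⟩, hlt'⟩, ?_⟩)
        exact Prod.ext (Prod.ext rfl hpat) hg
      · intro u _ u' _ heq
        exact congrArg Prod.snd heq
    · intro q hq
      exact Finset.mem_coe.2 (Finset.mem_product.2 ⟨Finset.mem_image_of_mem _ hq,
        Finset.mem_range.2 (lt_G _ (Finset.mem_product.1 (Finset.mem_filter.1 hq).1).2)⟩)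
  have card_Q₃ : 2 * Q₃.card ≤ (∑ h ∈ Finset.range K, h * B) + K * 3 ^ B * G := by
    calc 2 * Q₃.card ≤ 2 * ∑ q ∈ I₁ ×ˢ Finset.range G, (P (grp q.1 q.2)).card := by
          refine Nat.mul_le_mul_left 2 (Finset.card_biUnion_le.trans ?_)
          exact Finset.sum_le_sum fun q _ => Finset.card_image_le
      _ = ∑ q ∈ I₁ ×ˢ Finset.range G, 2 * (P (grp q.1 q.2)).card := Finset.mul_sum _ _ _
      _ ≤ ∑ q ∈ I₁ ×ˢ Finset.range G, ((grp q.1 q.2).card + 1) :=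
          Finset.sum_le_sum fun q _ => hP_card _
      _ = ∑ q ∈ I₁ ×ˢ Finset.range G, (grp q.1 q.2).card + I₁.card * G := by
          rw [Finset.sum_add_distrib]
          simp
      _ ≤ _ := add_le_add (sum_grp.trans card_D) (Nat.mul_le_mul_right _ card_I₁)
  have htotal : φ₂.card ≤ Q₀.card + Q₁.card + Q₂.card + Q₃.card := by
    refine (Finset.card_le_card hcover).trans ((Finset.card_union_le _ _).trans ?_)
    gcongr
    refine (Finset.card_union_le _ _).trans ?_
    gcongr
    exact Finset.card_union_le _ _
  omega

lemma exists_bvaChain_real_card_le {φ : Formula} (h2 : Is2CNF φ) (hs : IsSimple φ) {A B n : ℕ}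
    (hA : 0 < A) (hB : 0 < B) (hAn : A ≤ n) (hBn : B ≤ n) (hn : (Vars φ).card ≤ n) :
    ∃ φ' : Formula, Is2CNF φ' ∧ BVAChain φ φ' ∧
      (φ'.card : ℝ) ≤ (n : ℝ) ^ 2 / (4 * B) +
        (2 * n * B + 4 * n * 3 ^ B + 2 * n * A + n / 4 + 2 * n ^ 2 * 3 ^ B / A) := by
  obtain ⟨φ', hcnf, hchain, hcard⟩ := exists_bvaChain_card_le h2 hs hA hB rfl
  refine ⟨φ', hcnf, hchain, ?_⟩
  set q := n / B with hq
  set p := n / A with hp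
  have hmono : 2 * φ'.card ≤ 2 * (n * (B * 2) + (q + 1) * 3 ^ B * (B * 2) + n * A * 2) +
      (∑ h ∈ Finset.range (q + 1), h * B) + (q + 1) * 3 ^ B * (p + 1) := by
    have hqm : (Vars φ).card / B ≤ q := Nat.div_le_div_right hn
    have hpm : (Vars φ).card / A ≤ p := Nat.div_le_div_right hn
    refine hcard.trans ?_
    gcongr
  have hsum : 2 * ∑ h ∈ Finset.range (q + 1), h * B = q * B * (q + 1) := by
    rw [← Finset.sum_mul, mul_comm 2, mul_assoc, mul_comm B, ← mul_assoc,
      Finset.sum_range_id_mul_two]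
    simp only [Nat.add_sub_cancel]
    ring
  have hmono' : 4 * φ'.card ≤ 4 * (n * (B * 2) + (q + 1) * 3 ^ B * (B * 2) + n * A * 2) +
      q * B * (q + 1) + 2 * ((q + 1) * 3 ^ B * (p + 1)) := by omega
  have hr : 4 * (φ'.card : ℝ) ≤ 4 * (n * (B * 2) + (q + 1) * 3 ^ B * (B * 2) + n * A * 2) +
      q * B * (q + 1) + 2 * ((q + 1) * 3 ^ B * (p + 1)) := by exact_mod_cast hmono'
  have hB' : (1 : ℝ) ≤ B := by exact_mod_cast hB
  have hA' : (1 : ℝ) ≤ A := by exact_mod_cast hA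
  have hAn' : (A : ℝ) ≤ n := by exact_mod_cast hAn
  have hBn' : (B : ℝ) ≤ n := by exact_mod_cast hBn
  have hqB : (q : ℝ) * B ≤ n := by exact_mod_cast Nat.div_mul_le_self n B
  have hpA : (p : ℝ) * A ≤ n := by exact_mod_cast Nat.div_mul_le_self n A
  have hq0 : (0 : ℝ) ≤ q := q.cast_nonneg
  have hp0 : (0 : ℝ) ≤ p := p.cast_nonneg
  have hn0 : (0 : ℝ) ≤ n := n.cast_nonneg
  have hq1 : (q : ℝ) ≤ n / B := by rwa [le_div_iff₀ (by linarith)]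
  have hw : (0 : ℝ) < 3 ^ B := by positivity
  have t1 : ((q : ℝ) + 1) * 3 ^ B * (B * 2) ≤ 4 * n * 3 ^ B := by nlinarith
  have t2 : (q : ℝ) * B * (q + 1) ≤ n ^ 2 / B + n := by
    calc (q : ℝ) * B * (q + 1) ≤ n * (n / B + 1) := by gcongr
      _ = _ := by ring
  have hqn : (q : ℝ) + 1 ≤ 2 * n := by nlinarith
  have hpn : (p : ℝ) + 1 ≤ 2 * n / A := by
    rw [le_div_iff₀ (by linarith)]
    nlinarith
  have t3 : ((q : ℝ) + 1) * 3 ^ B * (p + 1) ≤ 4 * (n ^ 2 * 3 ^ B / A) := by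
    calc ((q : ℝ) + 1) * 3 ^ B * (p + 1) ≤ 2 * n * 3 ^ B * (2 * n / A) := by gcongr
      _ = _ := by ring
  have e1 : (n : ℝ) ^ 2 / (4 * B) = n ^ 2 / B / 4 := by ring
  have e2 : 2 * (n : ℝ) ^ 2 * 3 ^ B / A = 2 * (n ^ 2 * 3 ^ B / A) := by ring
  rw [e1, e2]
  linarith

open Filter in
/-- Good block lengths `B` and group sizes `A` exist for all large `n`. -/
lemma exists_parameters {ε : ℝ} (hε : 0 < ε) : ∃ N : ℕ, ∀ n : ℕ, N ≤ n →
    ∃ A B : ℕ, 0 < A ∧ 0 < B ∧ A ≤ n ∧ B ≤ n ∧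
      (n : ℝ) ^ 2 / (4 * B) +
        (2 * n * B + 4 * n * 3 ^ B + 2 * n * A + n / 4 + 2 * n ^ 2 * 3 ^ B / A) ≤
      (Real.logb 2 3 / 4 + ε) * (n : ℝ) ^ 2 / Real.logb 2 (n : ℝ) := by
  set a := Real.log 3 with ha
  have ha0 : 0 < a := Real.log_pos (by norm_num)
  have hl2 : 0 < Real.log 2 := Real.log_pos (by norm_num)
  set e := 2 * ε * Real.log 2 with he
  have he0 : 0 < e := by positivity
  set δ := e / (4 * (a + e)) with hδ
  have hδ0 : 0 < δ := by positivity
  have hδ1 : δ ≤ 1 / 4 := by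
    rw [hδ, div_le_iff₀ (by positivity)]
    linarith
  have hδe : 2 * δ * (a + e) = e / 2 := by
    rw [hδ]
    field_simp
    norm_num
  set c := e / 52 with hc
  have hc0 : 0 < c := by positivity
  have hlog : ∀ᶠ x : ℝ in atTop, 2 * a * (a + e) / e ≤ Real.log x :=
    Real.tendsto_log_atTop.eventually_ge_atTop _
  have hpow : ∀ᶠ x : ℝ in atTop, Real.log x ≤ c * x ^ δ := by
    filter_upwards [(isLittleO_log_rpow_atTop hδ0).bound hc0, eventually_ge_atTop 1] with x hx h1
    rwa [Real.norm_of_nonneg (Real.log_nonneg h1),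
      Real.norm_of_nonneg (Real.rpow_nonneg (by linarith) _)] at hx
  obtain ⟨N, hN⟩ := eventually_atTop.1 (tendsto_natCast_atTop_atTop.eventually
    (hlog.and (hpow.and (eventually_gt_atTop (1 : ℝ)))))
  refine ⟨N, fun n hn => ?_⟩
  obtain ⟨h1, h2, h3⟩ := hN n hn
  set x : ℝ := (n : ℝ) with hx
  have hx0 : 0 < x := by linarith
  have hL : 0 < Real.log x := Real.log_pos h3
  set B := ⌊(1 - 2 * δ) * Real.log x / a⌋₊ with hB
  set A := ⌈x ^ (1 - δ)⌉₊ with hA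
  have hBlow : (1 - 2 * δ) * Real.log x / a < B + 1 := Nat.lt_floor_add_one _
  have hBup : (B : ℝ) ≤ (1 - 2 * δ) * Real.log x / a :=
    Nat.floor_le (div_nonneg (mul_nonneg (by linarith) hL.le) ha0.le)
  have hBL : Real.log x ≤ (a + e) * B := by
    rw [div_lt_iff₀ ha0] at hBlow
    rw [div_le_iff₀ he0] at h1
    have h4 : (a + e) * ((1 - 2 * δ) * Real.log x) ≤ (a + e) * ((B + 1) * a) := by gcongr
    have h5 : (a + e) * ((1 - 2 * δ) * Real.log x) = (a + e / 2) * Real.log x := by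
      linear_combination (-Real.log x) * hδe
    have h6 : a * Real.log x ≤ a * ((a + e) * B) := by nlinarith
    exact le_of_mul_le_mul_left h6 ha0
  have hB0 : (0 : ℝ) < B := by
    by_contra hneg
    nlinarith
  have hpowB : (3 : ℝ) ^ B ≤ x ^ (1 - 2 * δ) := by
    rw [le_div_iff₀ ha0] at hBup
    rw [← Real.log_le_log_iff (by positivity) (by positivity), Real.log_pow, Real.log_rpow hx0]
    exact hBup
  set y := x ^ (1 - δ) with hy
  have hy0 : 0 < y := by positivity
  have hy1 : 1 ≤ y := Real.one_le_rpow h3.le (by linarith)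
  have hpowy : x ^ (1 - 2 * δ) ≤ y := Real.rpow_le_rpow_of_exponent_le h3.le (by linarith)
  have hyx : y ≤ x := by
    simpa using Real.rpow_le_rpow_of_exponent_le h3.le (show 1 - δ ≤ 1 by linarith)
  have hB3 : (B : ℝ) ≤ 3 ^ B := by exact_mod_cast (Nat.lt_pow_self (by norm_num : 1 < 3)).le
  have hyA : y ≤ A := Nat.le_ceil _
  have hA2 : (A : ℝ) ≤ 2 * y := by
    have := Nat.ceil_lt_add_one hy0.le
    linarith
  refine ⟨A, B, Nat.ceil_pos.2 hy0, by exact_mod_cast hB0, Nat.ceil_le.2 hyx, ?_, ?_⟩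
  · have : (B : ℝ) ≤ n := by linarith
    exact_mod_cast this
  have hyδ : y * x ^ δ = x := by
    rw [hy, ← Real.rpow_add hx0]
    simp
  have hyy : x * x ^ (1 - 2 * δ) = y * y := by
    rw [hy, ← Real.rpow_add hx0, ← Real.rpow_one_add' hx0.le (by linarith)]
    ring_nf
  have hlast : 2 * x ^ 2 * 3 ^ B / A ≤ 2 * (x * y) := by
    rw [div_le_iff₀ (by linarith)]
    calc 2 * x ^ 2 * 3 ^ B ≤ 2 * x ^ 2 * x ^ (1 - 2 * δ) := by gcongr
      _ = 2 * (x * y) * y := by linear_combination (2 * x) * hyy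
      _ ≤ 2 * (x * y) * A := by gcongr
  have hlow : 2 * x * B + 4 * x * 3 ^ B + 2 * x * A + x / 4 + 2 * x ^ 2 * 3 ^ B / A ≤
      13 * (x * y) := by
    have q1 : x * B ≤ x * y := by gcongr; linarith
    have q2 : x * 3 ^ B ≤ x * y := by gcongr; linarith
    have q3 : x * A ≤ x * (2 * y) := by gcongr
    have q4 : x * 1 ≤ x * y := by gcongr
    linarith
  have hmain : x ^ 2 / (4 * B) ≤ (a + e) * x ^ 2 / (4 * Real.log x) := by
    rw [div_le_div_iff₀ (by positivity) (by positivity)]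
    have := mul_le_mul_of_nonneg_left hBL (show 0 ≤ 4 * x ^ 2 by positivity)
    linarith
  have hrest : 13 * (x * y) ≤ e * x ^ 2 / (4 * Real.log x) := by
    rw [le_div_iff₀ (by positivity)]
    have := mul_le_mul_of_nonneg_left h2 (show 0 ≤ 52 * (x * y) by positivity)
    have h7 : 52 * (x * y) * (c * x ^ δ) = e * x ^ 2 := by
      rw [hc]
      linear_combination (e * x) * hyδ
    linarith
  have hfinal : (Real.logb 2 3 / 4 + ε) * x ^ 2 / Real.logb 2 x =
      (a + e) * x ^ 2 / (4 * Real.log x) + e * x ^ 2 / (4 * Real.log x) := by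
    rw [Real.logb, Real.logb, ← ha, he]
    field_simp
    ring
  rw [hfinal]
  linarith

/-- idealized BVA upper bound for simple 2-CNF formulas. -/
theorem bva_simple_upper (ε : ℝ) (hε : 0 < ε) :
    ∃ N : ℕ, ∀ n : ℕ, N ≤ n → ∀ φ : Formula, Is2CNF φ → IsSimple φ →
      (Vars φ).card ≤ n →
      ∃ φ' : Formula, Is2CNF φ' ∧ BVAChain φ φ' ∧
        (φ'.card : ℝ) ≤ (Real.logb 2 3 / 4 + ε) * (n : ℝ) ^ 2 / Real.logb 2 (n : ℝ) := by
  obtain ⟨N, hN⟩ := exists_parameters hε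
  refine ⟨N, fun n hn φ h2 hs hcard => ?_⟩
  obtain ⟨A, B, hA, hB, hAn, hBn, hle⟩ := hN n hn
  obtain ⟨φ', hcnf, hchain, hφ'⟩ := exists_bvaChain_real_card_le h2 hs hA hB hAn hBn hcard
  exact ⟨φ', hcnf, hchain, hφ'.trans hle⟩

end BVAPaper
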